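/- Let A = {a, b} with 0 < a < b. For every n ≥ 0, writing m = n mod (a + b), we have w^A(n) = 1 if m ≥ b, and w^A(n) = ⌊m/a⌋ mod 2 if m < b. Consequently preper(A) = 0, and per(A) = 2a if b is an odd multiple of a, while per(A) = a + b otherwise. -/

import Mathlib

open Classical in
/-- The winning sequence on ℕ, where `seed` gives values at negative positions. -/
noncomputable def subW (A : Set ℕ) (seed : ℤ → ℕ) : ℕ → ℕ := fun n =>
  Nat.strongRecOn n (fun n ih =>
    if ∃ x ∈ A, (if h : 0 < x ∧ x ≤ n then ih (n - x) (by omega)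
                 else seed ((n : ℤ) - (x : ℤ))) = 0
    then 1 else 0)

/-- The winning sequence `w^{A,seed} : ℤ → ℕ`. -/
noncomputable def W (A : Set ℕ) (seed : ℤ → ℕ) : ℤ → ℕ := fun n =>
  if 0 ≤ n then subW A seed n.toNat else seed n

/-- The trivial seed (all ones), giving the unseeded sequence `w^A`. -/
def one : ℤ → ℕ := fun _ => 1

/-- The seed function determined by a string `S ∈ {0,1}^L`: `w(-i) = S_i` for `1 ≤ i ≤ L`,
and `w(n) = 1` for `n < -L`. -/
def seedExt (L : ℕ) (S : ℕ → Bool) : ℤ → ℕ := fun j =>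
  if -(L : ℤ) ≤ j ∧ j < 0 then (if S ((-j).toNat - 1) then 1 else 0) else 1

/-- `w` is eventually periodic over `p`. -/
def PeriodicOver (w : ℤ → ℕ) (p : ℕ) : Prop :=
  ∃ N : ℕ, ∀ n : ℤ, (N : ℤ) ≤ n → w n = w (n + p)

/-- The (eventual) period: the least `p ≥ 1` over which `w` is eventually periodic. -/
noncomputable def per (w : ℤ → ℕ) : ℕ := sInf {p : ℕ | 0 < p ∧ PeriodicOver w p}

/-- The preperiod: the least `N` that works for `p = per w`. -/
noncomputable def preper (w : ℤ → ℕ) : ℕ :=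
  sInf {N : ℕ | ∀ n : ℤ, (N : ℤ) ≤ n → w n = w (n + per w)}

/-- The closed form of the unseeded winning sequence of `{a, b}` on the natural numbers. -/
def closedForm (a b n : ℕ) : ℕ :=
  if n % (a + b) < b then n % (a + b) / a % 2 else 1

lemma closedForm_mul_add {a b m : ℕ} (k : ℕ) (hm : m < a + b) :
    closedForm a b ((a + b) * k + m) = if m < b then m / a % 2 else 1 := by
  simp [closedForm, Nat.mod_eq_of_lt hm]

lemma closedForm_add_self (a b n : ℕ) : closedForm a b (n + (a + b)) = closedForm a b n := by
  simp [closedForm]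

lemma closedForm_lt_two (a b n : ℕ) : closedForm a b n < 2 := by
  unfold closedForm; split_ifs <;> omega

lemma exists_eq_mul_add {L : ℕ} (hL : 0 < L) (n : ℕ) : ∃ k m, m < L ∧ n = L * k + m :=
  ⟨n / L, n % L, Nat.mod_lt _ hL, (Nat.div_add_mod n L).symm⟩

lemma closedForm_eq_one_iff {a b : ℕ} (ha : 0 < a) (hab : a < b) (n : ℕ) :
    closedForm a b n = 1 ↔
      (a ≤ n ∧ closedForm a b (n - a) = 0) ∨ (b ≤ n ∧ closedForm a b (n - b) = 0) := by
  obtain ⟨k, m, hm, rfl⟩ := exists_eq_mul_add (by omega : 0 < a + b) n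
  rw [closedForm_mul_add k hm]
  rcases le_or_gt b m with hbm | hmb
  · have h : (a + b) * k + m - b = (a + b) * k + (m - b) := by omega
    rw [if_neg (by omega), h, closedForm_mul_add k (by omega), if_pos (by omega),
      Nat.div_eq_of_lt (by omega)]
    simp; omega
  · rw [if_pos hmb]
    have hB : ¬ (b ≤ (a + b) * k + m ∧ closedForm a b ((a + b) * k + m - b) = 0 ∧
        m / a % 2 = 0) := by
      rintro ⟨h1, h2, h3⟩
      rcases k with _ | k
      · omega
      · have h : (a + b) * (k + 1) + m - b = (a + b) * k + (m + a) := by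
          rw [Nat.mul_succ]; omega
        rw [h, closedForm_mul_add k (by omega), Nat.add_div_right _ ha] at h2
        split_ifs at h2; omega
    rcases le_or_gt a m with ham | hma
    · have h : (a + b) * k + m - a = (a + b) * k + (m - a) := by omega
      have hd : m / a = (m - a) / a + 1 := by
        rw [← Nat.add_div_right _ ha, Nat.sub_add_cancel ham]
      rw [h, closedForm_mul_add k (by omega), if_pos (by omega)]
      constructor
      · intro h1; left; omega
      · rintro (h1 | h1)
        · omega
        · by_contra h2; exact hB ⟨h1.1, h1.2, by omega⟩
    · have h0 : m / a = 0 := Nat.div_eq_of_lt hma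
      have hA : ¬ (a ≤ (a + b) * k + m ∧ closedForm a b ((a + b) * k + m - a) = 0) := by
        rintro ⟨h1, h2⟩
        rcases k with _ | k
        · omega
        · have h : (a + b) * (k + 1) + m - a = (a + b) * k + (m + b) := by
            rw [Nat.mul_succ]; omega
          rw [h, closedForm_mul_add k (by omega), if_neg (by omega)] at h2
          omega
      constructor
      · intro h1; omega
      · rintro (h1 | h1)
        · exact absurd h1 hA
        · exact absurd ⟨h1.1, h1.2, by omega⟩ hB

open Classical in
lemma subW_eq (A : Set ℕ) (seed : ℤ → ℕ) (n : ℕ) :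
    subW A seed n = if ∃ x ∈ A, (if 0 < x ∧ x ≤ n then subW A seed (n - x)
      else seed ((n : ℤ) - (x : ℤ))) = 0 then 1 else 0 := by
  conv_lhs => unfold subW; rw [Nat.strongRecOn_eq]
  rfl

lemma subW_pair {a b : ℕ} (ha : 0 < a) (hab : a < b) (n : ℕ) :
    subW {a, b} one n = closedForm a b n := by
  classical
  induction n using Nat.strong_induction_on with
  | _ n ih =>
    have key : ∀ x, 0 < x → ((if 0 < x ∧ x ≤ n then subW {a, b} one (n - x)
        else one ((n : ℤ) - (x : ℤ))) = 0 ↔ x ≤ n ∧ closedForm a b (n - x) = 0) := by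
      intro x hx
      by_cases h : x ≤ n
      · simp [hx, h, ih (n - x) (by omega)]
      · simp [h, one]
    have hiff := closedForm_eq_one_iff ha hab n
    have h2 := closedForm_lt_two a b n
    rw [subW_eq]
    simp only [Set.mem_insert_iff, Set.mem_singleton_iff, exists_eq_or_imp, exists_eq_left,
      key a ha, key b (by omega), ← hiff]
    split_ifs <;> omega

lemma W_pair {a b : ℕ} (ha : 0 < a) (hab : a < b) (n : ℕ) :
    W {a, b} one (n : ℤ) = closedForm a b n := by
  simp [W, subW_pair ha hab]

lemma W_pair_periodic_iff {a b : ℕ} (ha : 0 < a) (hab : a < b) (N p : ℕ) :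
    (∀ n : ℤ, (N : ℤ) ≤ n → W {a, b} one n = W {a, b} one (n + p)) ↔
      ∀ n : ℕ, N ≤ n → closedForm a b n = closedForm a b (n + p) := by
  constructor
  · intro h n hn
    have := h n (by exact_mod_cast hn)
    rwa [← Nat.cast_add, W_pair ha hab, W_pair ha hab] at this
  · intro h n hn
    lift n to ℕ using by omega
    rw [← Nat.cast_add, W_pair ha hab, W_pair ha hab]
    exact h n (by exact_mod_cast hn)

/-- A repeated value at distance `a` can only occur in the final block of ones. -/
lemma le_mod_of_closedForm_add_eq {a b n : ℕ} (ha : 0 < a) (hab : a < b)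
    (h : closedForm a b (n + a) = closedForm a b n) : b ≤ (n + a) % (a + b) := by
  obtain ⟨k, m, hm, rfl⟩ := exists_eq_mul_add (by omega : 0 < a + b) n
  by_contra! hlt
  rcases lt_or_ge m b with hmb | hbm
  · rw [add_assoc, Nat.mul_add_mod, Nat.mod_eq_of_lt (by omega)] at hlt
    rw [add_assoc, closedForm_mul_add k (by omega), closedForm_mul_add k hm, if_pos hlt,
      if_pos hmb, Nat.add_div_right _ ha] at h
    omega
  · have h' : (a + b) * k + m + a = (a + b) * (k + 1) + (m - b) := by
      rw [Nat.mul_succ]; omega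
    rw [h', closedForm_mul_add _ (by omega), closedForm_mul_add k hm, if_pos (by omega),
      if_neg (by omega), Nat.div_eq_of_lt (by omega)] at h
    omega

lemma closedForm_eq_of_odd_mul {a q : ℕ} (ha : 0 < a) (hq : Odd q) (n : ℕ) :
    closedForm a (q * a) n = n / a % 2 := by
  obtain ⟨r, rfl⟩ := hq
  obtain ⟨k, m, hm, rfl⟩ :=
    exists_eq_mul_add (by omega : 0 < a + (2 * r + 1) * a) n
  rw [closedForm_mul_add k hm]
  have h1 : (a + (2 * r + 1) * a) * k + m = m + a * (2 * ((r + 1) * k)) := by ring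
  rw [h1, Nat.add_mul_div_left _ _ ha, Nat.add_mul_mod_self_left]
  split_ifs with h
  · rfl
  · have : m / a = 2 * r + 1 := by
      apply Nat.div_eq_of_lt_le
      · omega
      · rw [Nat.succ_mul]; omega
    omega

lemma two_mul_le_of_periodic {a N p : ℕ} (ha : 0 < a) (hp : 0 < p)
    (h : ∀ n, N ≤ n → n / a % 2 = (n + p) / a % 2) : 2 * a ≤ p := by
  by_contra! hlt
  have hN : N ≤ a * (2 * N) := by nlinarith
  have h1 := h (a * (2 * N)) hN
  rw [Nat.mul_add_div ha, Nat.mul_div_cancel_left _ ha] at h1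
  rcases lt_or_ge p a with hpa | hpa
  · have h2 := h (a * (2 * N) + (a - p)) (by omega)
    rw [add_assoc, Nat.sub_add_cancel hpa.le, Nat.mul_add_div ha, Nat.mul_add_div ha,
      Nat.div_self ha, Nat.div_eq_of_lt (by omega)] at h2
    omega
  · have : p / a = 1 := Nat.div_eq_of_lt_le (by omega) (by omega)
    omega

/-- If `b` is not an odd multiple of `a`, some value is repeated at distance `a`. -/
lemma exists_closedForm_add_eq {a b : ℕ} (ha : 0 < a) (hab : a < b)
    (hodd : ¬ ∃ q : ℕ, Odd q ∧ b = q * a) (N : ℕ) :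
    ∃ n, N ≤ n ∧ closedForm a b (n + a) = closedForm a b n := by
  obtain ⟨m, hm1, hm2, hm3⟩ : ∃ m, b ≤ m + a ∧ m < b ∧ m / a % 2 = 1 := by
    by_contra! hno
    have hstart := hno (b - a) (by omega) (by omega)
    have hend := hno (b - 1) (by omega) (by omega)
    have hdiv : b / a = (b - a) / a + 1 := by
      rw [← Nat.add_div_right _ ha, Nat.sub_add_cancel hab.le]
    have hne : (b - 1) / a ≠ b / a := by
      intro h; rw [h] at hend; omega
    have hdvd : b / a * a = b := by
      by_contra hne'
      apply hne
      have h1 := Nat.div_mul_le_self b a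
      have h2 := Nat.lt_mul_of_div_lt (Nat.lt_succ_self (b / a)) ha
      apply Nat.div_eq_of_lt_le
      · omega
      · rw [Nat.succ_eq_add_one] at h2; omega
    exact hodd ⟨b / a, Nat.odd_iff.mpr (by omega), hdvd.symm⟩
  refine ⟨(a + b) * N + m, by nlinarith, ?_⟩
  rw [add_assoc, closedForm_mul_add N (by omega), closedForm_mul_add N (by omega),
    if_neg (by omega), if_pos hm2, hm3]

lemma not_periodic_of_le {a b N d : ℕ} (ha : 0 < a) (hab : a < b)
    (hodd : ¬ ∃ q : ℕ, Odd q ∧ b = q * a) (hd : 0 < d) (hdb : d ≤ b) :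
    ¬ ∀ n, N ≤ n → closedForm a b n = closedForm a b (n + d) := by
  intro h
  obtain ⟨n, hn, heq⟩ := exists_closedForm_add_eq ha hab hodd N
  have hall : ∀ j, closedForm a b (n + d * j + a) = closedForm a b (n + d * j) := by
    intro j
    induction j with
    | zero => simpa using heq
    | succ j ih =>
      have h1 := h (n + d * j + a) (by nlinarith)
      have h2 := h (n + d * j) (by nlinarith)
      rw [Nat.mul_succ, show n + (d * j + d) + a = n + d * j + a + d by ring,
        show n + (d * j + d) = n + d * j + d by ring]
      omega
  obtain ⟨k, m, hm, hk⟩ := exists_eq_mul_add (by omega : 0 < a + b) (n + a)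
  have hdm := Nat.div_add_mod (a + b - 1 - m) d
  have hlt := Nat.mod_lt (a + b - 1 - m) hd
  have hge := le_mod_of_closedForm_add_eq ha hab (hall ((a + b - 1 - m) / d + 1))
  set j := (a + b - 1 - m) / d
  have hrw : n + d * (j + 1) + a =
      (a + b) * (k + 1) + (m + d * j + d - (a + b)) := by
    rw [Nat.mul_succ, Nat.mul_succ]; omega
  rw [hrw, Nat.mul_add_mod, Nat.mod_eq_of_lt (by omega)] at hge
  omega

lemma add_le_of_periodic {a b N p : ℕ} (ha : 0 < a) (hab : a < b)
    (hodd : ¬ ∃ q : ℕ, Odd q ∧ b = q * a) (hp : 0 < p)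
    (h : ∀ n, N ≤ n → closedForm a b n = closedForm a b (n + p)) : a + b ≤ p := by
  by_contra! hlt
  rcases le_or_gt p b with hpb | hpb
  · exact not_periodic_of_le ha hab hodd hp hpb h
  · refine not_periodic_of_le (N := N) ha hab hodd (d := a + b - p) (by omega) (by omega) ?_
    intro n hn
    rw [h (n + (a + b - p)) (by omega), add_assoc, Nat.sub_add_cancel hlt.le,
      closedForm_add_self]

lemma per_pair_eq {a b P : ℕ} (ha : 0 < a) (hab : a < b) (hP : 0 < P)
    (hper : ∀ n, closedForm a b n = closedForm a b (n + P))
    (hmin : ∀ N p, 0 < p → (∀ n, N ≤ n → closedForm a b n = closedForm a b (n + p)) → P ≤ p) :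
    per (W {a, b} one) = P ∧ preper (W {a, b} one) = 0 := by
  have h1 : per (W {a, b} one) = P := by
    refine IsLeast.csInf_eq ⟨⟨hP, 0, ?_⟩, ?_⟩
    · exact (W_pair_periodic_iff ha hab 0 P).2 fun n _ => hper n
    · rintro p ⟨hp, N, hN⟩
      exact hmin N p hp ((W_pair_periodic_iff ha hab N p).1 hN)
  refine ⟨h1, ?_⟩
  refine Nat.sInf_eq_zero.2 (Or.inl ?_)
  rw [Set.mem_ofPred_eq, h1]
  exact (W_pair_periodic_iff ha hab 0 P).2 fun n _ => hper n

lemma per_pair_of_odd_mul {a b : ℕ} (ha : 0 < a) (hab : a < b)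
    (hodd : ∃ q : ℕ, Odd q ∧ b = q * a) :
    per (W {a, b} one) = 2 * a ∧ preper (W {a, b} one) = 0 := by
  obtain ⟨q, hq, rfl⟩ := hodd
  refine per_pair_eq ha hab (by omega) ?_ ?_
  · intro n
    rw [closedForm_eq_of_odd_mul ha hq, closedForm_eq_of_odd_mul ha hq,
      Nat.add_mul_div_right _ _ ha, Nat.add_mod_right]
  · intro N p hp h
    simp only [closedForm_eq_of_odd_mul ha hq] at h
    exact two_mul_le_of_periodic ha hp h

lemma per_pair_of_not_odd_mul {a b : ℕ} (ha : 0 < a) (hab : a < b)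
    (hodd : ¬ ∃ q : ℕ, Odd q ∧ b = q * a) :
    per (W {a, b} one) = a + b ∧ preper (W {a, b} one) = 0 :=
  per_pair_eq ha hab (by omega) (fun n => (closedForm_add_self a b n).symm)
    fun _ _ hp h => add_le_of_periodic ha hab hodd hp h

/-- the explicit structure of `w^{a,b}`: with `m = n mod (a+b)`,
`w(n) = 1` if `m ≥ b` and `w(n) = ⌊m/a⌋ mod 2` otherwise; hence `preper = 0`,
and `per = 2a` if `b` is an odd multiple of `a`, `per = a + b` otherwise. -/
theorem stmt_12 (a b : ℕ) (ha : 0 < a) (hab : a < b) :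
    (∀ n : ℕ, (b ≤ n % (a + b) → W {a, b} one (n : ℤ) = 1) ∧
              (n % (a + b) < b → W {a, b} one (n : ℤ) = (n % (a + b) / a) % 2)) ∧
    preper (W {a, b} one) = 0 ∧
    ((∃ q : ℕ, Odd q ∧ b = q * a) → per (W {a, b} one) = 2 * a) ∧
    (¬ (∃ q : ℕ, Odd q ∧ b = q * a) → per (W {a, b} one) = a + b) := by
  refine ⟨fun n => ?_, ?_, fun h => (per_pair_of_odd_mul ha hab h).1,
    fun h => (per_pair_of_not_odd_mul ha hab h).1⟩
  · rw [W_pair ha hab, closedForm]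
    exact ⟨fun h => if_neg (by omega), fun h => if_pos h⟩
  · by_cases h : ∃ q : ℕ, Odd q ∧ b = q * a
    · exact (per_pair_of_odd_mul ha hab h).2
    · exact (per_pair_of_not_odd_mul ha hab h).2
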